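/- Let Γ be an uncountable set and (a,b) an admissible pair of functions on Γ. Then the Banach space C(B(Γ,a,b)) of real-valued continuous functions with the supremum norm is isomorphic (linearly homeomorphic) to the Banach space C(B(Γ)). -/

import Mathlib

open Set Filter Topology

noncomputable section

/-- `Ball ι` is the "hilbertian ball" `B(ι) = {x ∈ ℝ^ι : ∑_i |x i| ≤ 1}` (expressed via
finite partial sums), carrying the topology inherited from the product topology on `ι → ℝ`. -/
def Ball (ι : Type*) : Set (ι → ℝ) :=
  {x | ∀ s : Finset ι, ∑ i ∈ s, |x i| ≤ 1}

/-- `BallAB ι a b` is `B(ι,a,b) = {x ∈ ℝ^ι : ∑_i |x i| ≤ 1 and a i ≤ x i ≤ b i for all i}`. -/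
def BallAB (ι : Type*) (a b : ι → ℝ) : Set (ι → ℝ) :=
  {x | x ∈ Ball ι ∧ ∀ i, a i ≤ x i ∧ x i ≤ b i}

/-- A pair `(a,b)` is admissible if `-1 ≤ a i ≤ 0 < b i ≤ 1` and `|a i| ≤ |b i|` for all `i`. -/
def Admissible {ι : Type*} (a b : ι → ℝ) : Prop :=
  ∀ i, -1 ≤ a i ∧ a i ≤ 0 ∧ 0 < b i ∧ b i ≤ 1 ∧ |a i| ≤ |b i|

theorem isCompact_ball (ι : Type*) : IsCompact (Ball ι) := by
  have hsub : Ball ι ⊆ Set.pi Set.univ (fun _ : ι => Set.Icc (-1:ℝ) 1) := by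
    intro x hx i _
    have h := hx {i}
    simp only [Finset.sum_singleton] at h
    simpa [Set.mem_Icc] using abs_le.mp h
  have hclosed : IsClosed (Ball ι) := by
    have : Ball ι = ⋂ s : Finset ι, {x : ι → ℝ | ∑ i ∈ s, |x i| ≤ 1} := by
      ext x; simp [Ball, Set.mem_iInter]
    rw [this]
    refine isClosed_iInter fun s => isClosed_le ?_ continuous_const
    exact continuous_finset_sum s fun i _ => (continuous_apply i).abs
  exact ((isCompact_univ_pi fun _ : ι => isCompact_Icc)).of_isClosed_subset hclosed hsub

instance Ball.compactSpace (ι : Type*) : CompactSpace (Ball ι) :=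
  isCompact_iff_compactSpace.mp (isCompact_ball ι)

theorem isCompact_ballAB (ι : Type*) (a b : ι → ℝ) : IsCompact (BallAB ι a b) := by
  refine (isCompact_ball ι).of_isClosed_subset ?_ (fun x hx => hx.1)
  have : BallAB ι a b =
      Ball ι ∩ ⋂ i, ({x : ι → ℝ | a i ≤ x i} ∩ {x : ι → ℝ | x i ≤ b i}) := by
    ext x
    simp only [BallAB, Set.mem_setOf_eq, Set.mem_inter_iff, Set.mem_iInter, forall_and]
  rw [this]
  have h1 : IsClosed (Ball ι) := by
    have h2 : Ball ι = ⋂ s : Finset ι, {x : ι → ℝ | ∑ i ∈ s, |x i| ≤ 1} := by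
      ext x; simp [Ball, Set.mem_iInter]
    rw [h2]
    refine isClosed_iInter fun s => isClosed_le ?_ continuous_const
    exact continuous_finset_sum s fun i _ => (continuous_apply i).abs
  refine h1.inter (isClosed_iInter fun i => IsClosed.inter ?_ ?_)
  · exact isClosed_le continuous_const (continuous_apply i)
  · exact isClosed_le (continuous_apply i) continuous_const

instance BallAB.compactSpace (ι : Type*) (a b : ι → ℝ) : CompactSpace (BallAB ι a b) :=
  isCompact_iff_compactSpace.mp (isCompact_ballAB ι a b)

section BanachPart

open ZeroAtInfty

lemma czero_norm_le {E : Type*} [NormedAddCommGroup E] (f : C₀(ℕ, E)) {C : ℝ} (hC : 0 ≤ C)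
    (h : ∀ n, ‖f n‖ ≤ C) : ‖f‖ ≤ C := by
  rw [← ZeroAtInftyContinuousMap.norm_toBCF_eq_norm]
  exact (BoundedContinuousFunction.norm_le hC).2 h

lemma czero_apply_le {E : Type*} [NormedAddCommGroup E] (f : C₀(ℕ, E)) (n : ℕ) :
    ‖f n‖ ≤ ‖f‖ := by
  rw [← ZeroAtInftyContinuousMap.norm_toBCF_eq_norm]
  exact f.toBCF.norm_coe_le_norm n

lemma czero_tendsto {E : Type*} [NormedAddCommGroup E] (f : C₀(ℕ, E)) :
    Tendsto (fun n => f n) atTop (𝓝 0) := by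
  have := f.zero_at_infty'
  rwa [cocompact_eq_cofinite, Nat.cofinite_eq_atTop] at this

/-- Build an element of `c₀(E)` from a null sequence. -/
def czeroMk {E : Type*} [NormedAddCommGroup E] (u : ℕ → E) (hu : Tendsto u atTop (𝓝 0)) :
    C₀(ℕ, E) where
  toFun := u
  continuous_toFun := continuous_of_discreteTopology
  zero_at_infty' := by rwa [cocompact_eq_cofinite, Nat.cofinite_eq_atTop]

@[simp] lemma czeroMk_apply {E : Type*} [NormedAddCommGroup E] (u : ℕ → E)
    (hu : Tendsto u atTop (𝓝 0)) (n : ℕ) : czeroMk u hu n = u n := rfl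

variable {E F G : Type*} [NormedAddCommGroup E] [NormedSpace ℝ E]
  [NormedAddCommGroup F] [NormedSpace ℝ F] [NormedAddCommGroup G] [NormedSpace ℝ G]

/-- A bounded linear operator into `c₀(F)` from its coordinates. -/
def czeroLift (u : ℕ → E →ₗ[ℝ] F) (C : ℝ) (hb : ∀ n x, ‖u n x‖ ≤ C * ‖x‖)
    (h0 : ∀ x, Tendsto (fun n => u n x) atTop (𝓝 0)) : E →L[ℝ] C₀(ℕ, F) :=
  LinearMap.mkContinuous
    { toFun := fun x => czeroMk (fun n => u n x) (h0 x)
      map_add' := fun x y => by ext n; simp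
      map_smul' := fun c x => by ext n; simp } C
    (fun x => czero_norm_le _ ((norm_nonneg _).trans (hb 0 x)) (fun n => hb n x))

@[simp] lemma czeroLift_apply (u : ℕ → E →ₗ[ℝ] F) (C : ℝ) (hb : ∀ n x, ‖u n x‖ ≤ C * ‖x‖)
    (h0 : ∀ x, Tendsto (fun n => u n x) atTop (𝓝 0)) (x : E) (n : ℕ) :
    czeroLift u C hb h0 x n = u n x := rfl

/-- Coordinate evaluation on `c₀(E)`. -/
def czeroEval (n : ℕ) : C₀(ℕ, E) →L[ℝ] E :=
  LinearMap.mkContinuous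
    { toFun := fun x => x n
      map_add' := fun x y => rfl
      map_smul' := fun c x => rfl } 1 (fun x => by simpa using czero_apply_le x n)

@[simp] lemma czeroEval_apply (n : ℕ) (x : C₀(ℕ, E)) : czeroEval n x = x n := rfl

/-- Functoriality of `c₀`. -/
def czeroMap (A : E →L[ℝ] F) : C₀(ℕ, E) →L[ℝ] C₀(ℕ, F) :=
  czeroLift (fun n => (A.comp (czeroEval n)).toLinearMap) ‖A‖
    (fun n x => (A.le_opNorm _).trans
      (mul_le_mul_of_nonneg_left (czero_apply_le x n) (norm_nonneg _)))
    (fun x => by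
      have := (A.continuous.tendsto 0).comp (czero_tendsto x)
      rw [map_zero] at this
      exact this)

@[simp] lemma czeroMap_apply (A : E →L[ℝ] F) (x : C₀(ℕ, E)) (n : ℕ) :
    czeroMap A x n = A (x n) := rfl

/-- `c₀` respects isomorphisms. -/
def czeroCongr (A : E ≃L[ℝ] F) : C₀(ℕ, E) ≃L[ℝ] C₀(ℕ, F) :=
  ContinuousLinearEquiv.equivOfInverse (czeroMap (A : E →L[ℝ] F)) (czeroMap (A.symm : F →L[ℝ] E))
    (fun x => by ext n; simp) (fun x => by ext n; simp)

/-- `c₀(E × F) ≅ c₀(E) × c₀(F)`. -/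
def czeroProd : C₀(ℕ, E × F) ≃L[ℝ] C₀(ℕ, E) × C₀(ℕ, F) :=
  ContinuousLinearEquiv.equivOfInverse
    ((czeroMap (ContinuousLinearMap.fst ℝ E F)).prod (czeroMap (ContinuousLinearMap.snd ℝ E F)))
    ((czeroMap (ContinuousLinearMap.inl ℝ E F)).coprod (czeroMap (ContinuousLinearMap.inr ℝ E F)))
    (fun x => by ext n <;> simp)
    (fun x => by
      refine Prod.ext ?_ ?_ <;> ext n <;> simp)

/-- `c₀(E) ≅ E × c₀(E)`. -/
def czeroShift : C₀(ℕ, E) ≃L[ℝ] E × C₀(ℕ, E) :=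
  ContinuousLinearEquiv.equivOfInverse
    ((czeroEval 0).prod (czeroLift (fun n => (czeroEval (E := E) (n + 1)).toLinearMap) 1
      (fun n x => by simpa using czero_apply_le x (n + 1))
      (fun x => (czero_tendsto x).comp (tendsto_add_atTop_nat 1))))
    (czeroLift (fun n => match n with
        | 0 => LinearMap.fst ℝ E C₀(ℕ, E)
        | n + 1 => (czeroEval n).toLinearMap.comp (LinearMap.snd ℝ E C₀(ℕ, E))) 1
      (fun n x => by
        cases n with
        | zero => simpa using norm_fst_le x
        | succ n => simpa using (czero_apply_le x.2 n).trans (norm_snd_le x))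
      (fun x => by
        rw [← tendsto_add_atTop_iff_nat 1]
        exact czero_tendsto x.2))
    (fun x => by ext n; cases n <;> rfl)
    (fun x => by
      refine Prod.ext ?_ ?_
      · rfl
      · ext n; rfl)

/-- A complemented subspace gives a decomposition. -/
lemma decomposition {X Y Z : Type*} [NormedAddCommGroup X] [NormedSpace ℝ X]
    [NormedAddCommGroup Y] [NormedSpace ℝ Y] [NormedAddCommGroup Z] [NormedSpace ℝ Z]
    {W V : Type*} [NormedAddCommGroup W] [NormedSpace ℝ W]
    [NormedAddCommGroup V] [NormedSpace ℝ V]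
    (e₁ : X ≃L[ℝ] Y × W) (e₂ : Y ≃L[ℝ] X × V) (e₃ : X ≃L[ℝ] C₀(ℕ, X) × Z) :
    Nonempty (Y ≃L[ℝ] X) := by
  -- `X ≅ X × X`
  have hXX : X ≃L[ℝ] X × X :=
    e₃.trans <| (czeroShift.prodCongr (.refl ℝ Z)).trans <|
      (ContinuousLinearEquiv.prodAssoc ℝ X C₀(ℕ, X) Z).trans <|
        (ContinuousLinearEquiv.refl ℝ X).prodCongr e₃.symm
  -- `Y ≅ X × Y`
  have hY : Y ≃L[ℝ] X × Y :=
    e₂.trans <| (hXX.prodCongr (.refl ℝ V)).trans <|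
      (ContinuousLinearEquiv.prodAssoc ℝ X X V).trans <|
        (ContinuousLinearEquiv.refl ℝ X).prodCongr e₂.symm
  -- `c₀(X) ≅ Y × c₀(X)`
  have hc : C₀(ℕ, X) ≃L[ℝ] Y × C₀(ℕ, X) :=
    (czeroCongr e₁).trans <| czeroProd.trans <| (czeroShift.prodCongr (.refl ℝ _)).trans <|
      (ContinuousLinearEquiv.prodAssoc ℝ _ _ _).trans <|
        (ContinuousLinearEquiv.refl ℝ Y).prodCongr (czeroProd.symm.trans (czeroCongr e₁).symm)
  -- `X ≅ Y × X`
  have hX : X ≃L[ℝ] Y × X :=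
    e₃.trans <| (hc.prodCongr (.refl ℝ Z)).trans <|
      (ContinuousLinearEquiv.prodAssoc ℝ _ _ _).trans <|
        (ContinuousLinearEquiv.refl ℝ Y).prodCongr e₃.symm
  exact ⟨hY.trans <| (ContinuousLinearEquiv.prodComm ℝ X Y).trans hX.symm⟩

/-- Pełczyński decomposition in the form used here. -/
lemma pelczynski {X Y : Type*} [NormedAddCommGroup X] [NormedSpace ℝ X]
    [NormedAddCommGroup Y] [NormedSpace ℝ Y]
    (P₁ : X →L[ℝ] Y) (S₁ : Y →L[ℝ] X) (h₁ : ∀ y, P₁ (S₁ y) = y)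
    (P₂ : Y →L[ℝ] X) (S₂ : X →L[ℝ] Y) (h₂ : ∀ x, P₂ (S₂ x) = x)
    (P₃ : X →L[ℝ] C₀(ℕ, X)) (S₃ : C₀(ℕ, X) →L[ℝ] X) (h₃ : ∀ x, P₃ (S₃ x) = x) :
    Nonempty (Y ≃L[ℝ] X) :=
  decomposition (ContinuousLinearEquiv.equivOfRightInverse P₁ S₁ h₁)
    (ContinuousLinearEquiv.equivOfRightInverse P₂ S₂ h₂)
    (ContinuousLinearEquiv.equivOfRightInverse P₃ S₃ h₃)

end BanachPart

section Combinatorics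

open Cardinal in
lemma exists_family {Γ : Type*} [Uncountable Γ] (b : Γ → ℝ) (hb : ∀ i, 0 < b i) :
    ∃ F : Γ × Bool → Finset Γ, (∀ j k, j ≠ k → Disjoint (F j) (F k)) ∧
      ∀ j, 1 ≤ ∑ i ∈ F j, b i := by
  classical
  obtain ⟨M, hM⟩ := zorn_subset
    {A : Set (Finset Γ) | A.PairwiseDisjoint id ∧ ∀ s ∈ A, 1 ≤ ∑ i ∈ s, b i} (by
      intro c hc hchain
      refine ⟨⋃₀ c, ⟨?_, ?_⟩, fun s hs => subset_sUnion_of_mem hs⟩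
      · exact (pairwiseDisjoint_sUnion hchain.directedOn).2 fun s hs => (hc hs).1
      · rintro s ⟨A, hA, hs⟩
        exact (hc hA).2 s hs)
  have hdis := hM.prop.1
  have hsum := hM.prop.2
  set U : Set Γ := ⋃ s : M, ((s : Finset Γ) : Set Γ) with hU
  have hcount : (Uᶜ).Countable := by
    have hle : ∀ t : Finset (Uᶜ : Set Γ), ∑ i ∈ t, b i ≤ 1 := by
      intro t
      by_contra! hlt
      set t' : Finset Γ := t.map (Function.Embedding.subtype _) with ht'
      have ht'sum : 1 ≤ ∑ i ∈ t', b i := by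
        rw [ht', Finset.sum_map]; exact hlt.le
      have hdisj : ∀ s ∈ M, Disjoint t' s := by
        intro s hs
        rw [Finset.disjoint_left]
        intro i hi his
        rw [ht', Finset.mem_map] at hi
        obtain ⟨⟨k, hk⟩, _, rfl⟩ := hi
        exact hk (mem_iUnion.2 ⟨⟨s, hs⟩, his⟩)
      have hmem : t' ∈ M := by
        refine hM.le_of_ge (y := insert t' M) ⟨?_, ?_⟩ (subset_insert _ _) (mem_insert _ _)
        · exact hdis.insert fun s hs _ => hdisj s hs
        · rintro s (rfl | hs)
          · exact ht'sum
          · exact hsum s hs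
      have := hdisj t' hmem
      rw [disjoint_self] at this
      rw [this] at ht'sum
      simp at ht'sum
      linarith
    have hs : Summable (fun i : (Uᶜ : Set Γ) => (b i).toNNReal) :=
      (summable_of_sum_le (f := fun i : (Uᶜ : Set Γ) => b i) (fun i => (hb i).le) hle).toNNReal
    have h2 := hs.countable_support_nnreal
    have h3 : Function.support (fun i : (Uᶜ : Set Γ) => (b i).toNNReal) = Set.univ := by
      ext i
      simp only [Function.mem_support, mem_univ, iff_true]
      exact (Real.toNNReal_pos.2 (hb i)).ne'
    rw [h3] at h2
    exact countable_coe_iff.1 (countable_univ_iff.1 h2)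
  have hΓ : ℵ₀ < #Γ := aleph0_lt_mk_iff.2 inferInstance
  have hU1 : #U ≤ #M * ℵ₀ := by
    refine (mk_iUnion_le _).trans (mul_le_mul_right ?_ _)
    exact ciSup_le' fun s => (lt_aleph0_of_finite _).le
  have hU2 : #Γ ≤ #U + ℵ₀ := by
    rw [← mk_sum_compl U]
    exact add_le_add_right (le_aleph0_iff_set_countable.2 hcount) _
  have hMinf : ℵ₀ ≤ #M := by
    by_contra! h
    have : #Γ ≤ ℵ₀ := hU2.trans (by
      refine (add_le_add_left (hU1.trans (mul_le_mul_left h.le _)) _).trans ?_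
      simp)
    exact absurd this (not_le.2 hΓ)
  have hMΓ : #Γ ≤ #M := by
    refine hU2.trans ((add_le_add_left hU1 _).trans ?_)
    rw [mul_eq_left hMinf hMinf aleph0_ne_zero, add_eq_left hMinf hMinf]
  have hΓB : #(Γ × Bool) ≤ #M := by
    rw [mk_prod, lift_id', mk_bool]
    refine le_trans ?_ hMΓ
    simp only [lift_ofNat]
    rw [mul_eq_left hΓ.le ((ofNat_lt_aleph0 (n := 2)).le.trans hΓ.le) two_ne_zero]
  obtain ⟨f⟩ := (Cardinal.le_def _ _).1 hΓB
  refine ⟨fun j => (f j : Finset Γ), fun j k hjk => ?_, fun j => hsum _ (f j).2⟩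
  exact hdis (f j).2 (f k).2 fun h => hjk (f.injective (Subtype.ext h))

end Combinatorics

section TopologyPart

lemma Ball.abs_le {ι : Type*} (x : Ball ι) (i : ι) : |x.1 i| ≤ 1 := by
  simpa using x.2 {i}

/-- clipping `Ball → BallAB`. -/
def clipMap {Γ : Type*} (a b : Γ → ℝ) (hab : Admissible a b) : C(Ball Γ, BallAB Γ a b) where
  toFun x := ⟨fun i => max (a i) (min (b i) (x.1 i)), by
    refine ⟨fun s => le_trans (Finset.sum_le_sum fun i _ => ?_) (x.2 s), fun i => ?_⟩
    · obtain ⟨_, h1, h2, _, _⟩ := hab i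
      change |max (a i) (min (b i) (x.1 i))| ≤ |x.1 i|
      rcases le_total 0 (x.1 i) with h | h
      · rw [abs_of_nonneg h, max_eq_right (h1.trans (le_min h2.le h)),
          abs_of_nonneg (le_min h2.le h)]
        exact min_le_right _ _
      · rw [abs_of_nonpos h, min_eq_right (h.trans h2.le), abs_of_nonpos (max_le h1 h)]
        exact neg_le_neg (le_max_right _ _)
    · obtain ⟨_, h1, h2, _, _⟩ := hab i
      exact ⟨le_max_left _ _, max_le (h1.trans h2.le) (min_le_left _ _)⟩⟩
  continuous_toFun := by
    refine Continuous.subtype_mk (continuous_pi fun i => ?_) _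
    exact continuous_const.max (continuous_const.min
      ((continuous_apply i).comp continuous_subtype_val))

/-- inclusion `BallAB → Ball`. -/
def inclMap {Γ : Type*} (a b : Γ → ℝ) : C(BallAB Γ a b, Ball Γ) where
  toFun x := ⟨x.1, x.2.1⟩
  continuous_toFun := continuous_subtype_val.subtype_mk _

lemma clip_incl {Γ : Type*} (a b : Γ → ℝ) (hab : Admissible a b) (x : BallAB Γ a b) :
    clipMap a b hab (inclMap a b x) = x := by
  refine Subtype.ext (funext fun i => ?_)
  have := x.2.2 i
  change max (a i) (min (b i) (x.1 i)) = x.1 i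
  rw [min_eq_right this.2, max_eq_right this.1]

/-- positive and negative parts -/
def signPart {Γ : Type*} (x : Γ → ℝ) (j : Γ × Bool) : ℝ :=
  max (if j.2 then x j.1 else - x j.1) 0

lemma signPart_nonneg {Γ : Type*} (x : Γ → ℝ) (j : Γ × Bool) : 0 ≤ signPart x j :=
  le_max_right _ _

lemma signPart_sub {Γ : Type*} (x : Γ → ℝ) (γ : Γ) :
    signPart x (γ, true) - signPart x (γ, false) = x γ := by
  simp only [signPart]
  rcases le_total 0 (x γ) with h | h <;> simp [h]

lemma signPart_add {Γ : Type*} (x : Γ → ℝ) (γ : Γ) :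
    signPart x (γ, true) + signPart x (γ, false) = |x γ| := by
  simp only [signPart]
  rcases le_total 0 (x γ) with h | h
  · simp [h, abs_of_nonneg h]
  · simp [h, abs_of_nonpos h]

lemma signPart_le {Γ : Type*} (x : Γ → ℝ) (j : Γ × Bool) : signPart x j ≤ |x j.1| := by
  refine max_le ?_ (abs_nonneg _)
  split_ifs
  · exact le_abs_self _
  · exact neg_le_abs _

lemma signPart_sum {Γ : Type*} (x : Ball Γ) (s : Finset (Γ × Bool)) :
    ∑ j ∈ s, signPart x.1 j ≤ 1 := by
  classical
  calc ∑ j ∈ s, signPart x.1 j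
      ≤ ∑ j ∈ (s.image Prod.fst) ×ˢ (Finset.univ : Finset Bool), signPart x.1 j := by
        refine Finset.sum_le_sum_of_subset_of_nonneg (fun j hj => ?_)
          (fun j _ _ => signPart_nonneg _ _)
        simp only [Finset.mem_product, Finset.mem_univ, and_true]
        exact Finset.mem_image_of_mem _ hj
    _ = ∑ γ ∈ s.image Prod.fst, |x.1 γ| := by
        rw [Finset.sum_product]
        refine Finset.sum_congr rfl fun γ _ => ?_
        rw [Fintype.sum_bool, signPart_add]
    _ ≤ 1 := x.2 _

/-- `Ball Γ` is a retract of `BallAB Γ a b`. -/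
lemma exists_retract {Γ : Type*} [Uncountable Γ] (a b : Γ → ℝ) (hab : Admissible a b) :
    ∃ (s : C(Ball Γ, BallAB Γ a b)) (p : C(BallAB Γ a b, Ball Γ)), ∀ x, p (s x) = x := by
  classical
  obtain ⟨F, hF, hF1⟩ := exists_family b (fun i => (hab i).2.2.1)
  -- index of a point
  let q : Γ → Option (Γ × Bool) := fun i => if h : ∃ j, i ∈ F j then some h.choose else none
  have hq : ∀ i j, i ∈ F j → q i = some j := by
    intro i j hij
    have h : ∃ j, i ∈ F j := ⟨j, hij⟩
    simp only [q, dif_pos h, Option.some.injEq]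
    by_contra hne
    exact (Finset.disjoint_left.1 (hF _ _ hne)) h.choose_spec hij
  have hq' : ∀ i j, q i = some j → i ∈ F j := by
    intro i j hij
    by_cases h : ∃ j, i ∈ F j
    · simp only [q, dif_pos h, Option.some.injEq] at hij
      exact hij ▸ h.choose_spec
    · simp only [q, dif_neg h, reduceCtorEq] at hij
  let B : Γ × Bool → ℝ := fun j => ∑ i ∈ F j, b i
  have hB : ∀ j, 1 ≤ B j := hF1
  let y : (Γ → ℝ) → Γ → ℝ := fun x i =>
    (q i).elim 0 (fun j => b i / B j * signPart x j)
  have hy0 : ∀ x i, 0 ≤ y x i := by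
    intro x i
    rcases h : q i with _ | j
    · simp [y, h]
    · simp only [y, h, Option.elim_some]
      exact mul_nonneg (div_nonneg (hab i).2.2.1.le (zero_le_one.trans (hB j)))
        (signPart_nonneg _ _)
  have hyb : ∀ (x : Ball Γ) i, y x.1 i ≤ b i := by
    intro x i
    have hb0 := (hab i).2.2.1
    rcases h : q i with _ | j
    · simpa [y, h] using hb0.le
    · simp only [y, h, Option.elim_some]
      have h1 : b i / B j ≤ b i := div_le_self hb0.le (hB j)
      have h2 : signPart x.1 j ≤ 1 := (signPart_le _ _).trans (Ball.abs_le x _)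
      calc b i / B j * signPart x.1 j ≤ b i * 1 :=
            mul_le_mul h1 h2 (signPart_nonneg _ _) hb0.le
        _ = b i := mul_one _
  have hyF : ∀ x j, ∑ i ∈ F j, y x i = signPart x j := by
    intro x j
    have : ∀ i ∈ F j, y x i = b i / B j * signPart x j := by
      intro i hi
      simp [y, hq i j hi]
    rw [Finset.sum_congr rfl this, ← Finset.sum_mul, ← Finset.sum_div]
    change B j / B j * _ = _
    rw [div_self (by linarith [hB j]), one_mul]
  have hdisj : ∀ J : Finset (Γ × Bool), (J : Set (Γ × Bool)).PairwiseDisjoint F :=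
    fun J j _ k _ hjk => hF j k hjk
  have hyball : ∀ x : Ball Γ, y x.1 ∈ Ball Γ := by
    intro x s
    let J : Finset (Γ × Bool) := s.biUnion fun i => (q i).toFinset
    calc ∑ i ∈ s, |y x.1 i| = ∑ i ∈ s, y x.1 i :=
          Finset.sum_congr rfl fun i _ => abs_of_nonneg (hy0 _ _)
      _ = ∑ i ∈ s with (q i).isSome, y x.1 i := by
          rw [Finset.sum_filter]
          refine Finset.sum_congr rfl fun i _ => ?_
          rcases h : q i with _ | j <;> simp [y, h]
      _ ≤ ∑ i ∈ J.biUnion F, y x.1 i := by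
          refine Finset.sum_le_sum_of_subset_of_nonneg (fun i hi => ?_) (fun _ _ _ => hy0 _ _)
          rw [Finset.mem_filter] at hi
          obtain ⟨j, hj⟩ := Option.isSome_iff_exists.1 hi.2
          refine Finset.mem_biUnion.2 ⟨j, ?_, hq' i j hj⟩
          exact Finset.mem_biUnion.2 ⟨i, hi.1, by simp [hj]⟩
      _ = ∑ j ∈ J, signPart x.1 j := by
          rw [Finset.sum_biUnion (hdisj J)]
          exact Finset.sum_congr rfl fun j _ => hyF _ _
      _ ≤ 1 := signPart_sum x J
  have hycont : Continuous y := by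
    refine continuous_pi fun i => ?_
    rcases h : q i with _ | ⟨γ, t⟩
    · simp only [y, h, Option.elim_none]; exact continuous_const
    · simp only [y, h, Option.elim_some, signPart]
      cases t
      · simp only [Bool.false_eq_true, if_false]; fun_prop
      · simp only [if_true]; fun_prop
  let s : C(Ball Γ, BallAB Γ a b) :=
    { toFun := fun x => ⟨y x.1, hyball x, fun i => ⟨(hab i).2.1.trans (hy0 _ _), hyb x i⟩⟩
      continuous_toFun := (hycont.comp continuous_subtype_val).subtype_mk _ }
  let z : (Γ → ℝ) → Γ → ℝ := fun y γ => ∑ i ∈ F (γ, true), y i - ∑ i ∈ F (γ, false), y i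
  have hz : ∀ y ∈ Ball Γ, z y ∈ Ball Γ := by
    intro y hy s
    calc ∑ γ ∈ s, |z y γ|
        ≤ ∑ γ ∈ s, ∑ t : Bool, ∑ i ∈ F (γ, t), |y i| := by
          refine Finset.sum_le_sum fun γ _ => ?_
          rw [Fintype.sum_bool]
          refine (abs_sub _ _).trans (add_le_add ?_ ?_) <;> exact Finset.abs_sum_le_sum_abs _ _
      _ = ∑ j ∈ s ×ˢ (Finset.univ : Finset Bool), ∑ i ∈ F j, |y i| := by
          rw [Finset.sum_product]
      _ = ∑ i ∈ (s ×ˢ (Finset.univ : Finset Bool)).biUnion F, |y i| := by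
          rw [Finset.sum_biUnion (hdisj _)]
      _ ≤ 1 := hy _
  have hzcont : Continuous z := by
    refine continuous_pi fun γ => ?_
    simp only [z]; fun_prop
  let p : C(BallAB Γ a b, Ball Γ) :=
    { toFun := fun y => ⟨z y.1, hz _ y.2.1⟩
      continuous_toFun := (hzcont.comp continuous_subtype_val).subtype_mk _ }
  refine ⟨s, p, fun x => Subtype.ext (funext fun γ => ?_)⟩
  change ∑ i ∈ F (γ, true), y x.1 i - ∑ i ∈ F (γ, false), y x.1 i = x.1 γ
  rw [hyF, hyF, signPart_sub]

end TopologyPart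

section CZeroPart

open ZeroAtInfty

/-- reindexing a ball along an injection -/
def reindex {ι κ : Type*} (e : κ ≃ ι) : C(Ball ι, Ball κ) where
  toFun x := ⟨fun k => x.1 (e k), fun s => by
    have := x.2 (s.map e.toEmbedding)
    rw [Finset.sum_map] at this
    exact this⟩
  continuous_toFun := by
    refine Continuous.subtype_mk (continuous_pi fun i => ?_) _
    exact (continuous_apply _).comp continuous_subtype_val

lemma reindex_reindex {ι κ : Type*} (e : κ ≃ ι) (x : Ball ι) :
    reindex e.symm (reindex e x) = x :=
  Subtype.ext (funext fun i => congrArg x.1 (e.apply_symm_apply i))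

lemma ball_option_le {Γ : Type*} (x : Ball (Option Γ)) (s : Finset Γ) :
    ∑ i ∈ s, |x.1 (some i)| ≤ 1 - |x.1 none| := by
  have := x.2 (Finset.insertNone s)
  rw [Finset.sum_insertNone] at this
  linarith

lemma mem_ball_option {Γ : Type*} (x : Option Γ → ℝ)
    (h : ∀ s : Finset Γ, |x none| + ∑ i ∈ s, |x (some i)| ≤ 1) : x ∈ Ball (Option Γ) := by
  classical
  intro s
  refine le_trans (Finset.sum_le_sum_of_subset_of_nonneg (t := Finset.insertNone s.eraseNone)
    ?_ (fun _ _ _ => abs_nonneg _)) ?_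
  · intro i hi
    cases i <;> simp [hi]
  · rw [Finset.sum_insertNone]; exact h _

/-- The point of the big ball at height `1 - u` over `y`. -/
def coneMap (Γ : Type*) : C(unitInterval × Ball Γ, Ball (Option Γ)) where
  toFun z := ⟨fun o => o.elim (1 - (z.1 : ℝ)) (fun i => z.1 * z.2.1 i), by
    refine mem_ball_option _ fun s => ?_
    have h0 := z.1.2.1
    have h1 := z.1.2.2
    have := mul_le_mul_of_nonneg_left (z.2.2 s) h0
    simp only [Option.elim_none, Option.elim_some, abs_mul, abs_of_nonneg h0,
      abs_of_nonneg (sub_nonneg.2 h1), ← Finset.mul_sum]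
    linarith⟩
  continuous_toFun := by
    refine Continuous.subtype_mk (continuous_pi fun o => ?_) _
    cases o with
    | none => simp only [Option.elim_none]; fun_prop
    | some i =>
      simp only [Option.elim_some]
      exact (continuous_subtype_val.comp continuous_fst).mul
        ((continuous_apply i).comp (continuous_subtype_val.comp continuous_snd))

/-- the heights `2^{-n}` -/
def hgt (n : ℕ) : unitInterval := ⟨(1 / 2 : ℝ) ^ n, by positivity, pow_le_one₀ (by norm_num) (by norm_num)⟩

lemma hgt_pos (n : ℕ) : 0 < (hgt n : ℝ) := by
  change 0 < (1 / 2 : ℝ) ^ n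
  positivity

lemma hgt_tendsto : Tendsto hgt atTop (𝓝 0) := by
  rw [tendsto_subtype_rng]
  exact tendsto_pow_atTop_nhds_zero_of_lt_one (by norm_num) (by norm_num)

/-- The retraction-like map onto the small ball. -/
def thetaMap (Γ : Type*) (n : ℕ) : C(Ball (Option Γ), Ball Γ) where
  toFun x := ⟨fun i => x.1 (some i) / max (1 - x.1 none) (hgt n), fun s => by
    have h := ball_option_le x s
    have hp : 0 < max (1 - x.1 none) (hgt n : ℝ) := lt_max_of_lt_right (hgt_pos n)
    simp only [abs_div, abs_of_pos hp, ← Finset.sum_div]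
    rw [div_le_one hp]
    refine h.trans (le_trans ?_ (le_max_left _ _))
    linarith [le_abs_self (x.1 none)]⟩
  continuous_toFun := by
    refine Continuous.subtype_mk (continuous_pi fun i => ?_) _
    refine Continuous.div ?_ ?_ fun x => (lt_max_of_lt_right (hgt_pos n)).ne'
    · exact (continuous_apply _).comp continuous_subtype_val
    · exact (continuous_const.sub ((continuous_apply _).comp continuous_subtype_val)).max
        continuous_const

/-- bump functions -/
def bump (n : ℕ) (u : ℝ) : ℝ := max 0 (1 - |4 * (u / hgt n) - 4|)

lemma bump_nonneg (n : ℕ) (u : ℝ) : 0 ≤ bump n u := le_max_left _ _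

lemma bump_le (n : ℕ) (u : ℝ) : bump n u ≤ 1 :=
  max_le zero_le_one (by linarith [abs_nonneg (4 * (u / hgt n) - 4)])

lemma bump_self (n : ℕ) : bump n (hgt n) = 1 := by
  simp [bump, div_self (hgt_pos n).ne']

lemma bump_zero (n : ℕ) : bump n 0 = 0 := by
  simp [bump]

lemma bump_ne_zero {n : ℕ} {u : ℝ} (h : bump n u ≠ 0) :
    3 / 4 * (hgt n : ℝ) < u ∧ u < 5 / 4 * (hgt n : ℝ) := by
  have h1 : |4 * (u / hgt n) - 4| < 1 := by
    by_contra! hc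
    exact h (max_eq_left (by linarith))
  rw [abs_lt] at h1
  have hp := hgt_pos n
  have e : u = u / hgt n * hgt n := by field_simp
  constructor
  · rw [e]; exact mul_lt_mul_of_pos_right (by linarith) hp
  · rw [e]; exact mul_lt_mul_of_pos_right (by linarith) hp

lemma hgt_lt {n m : ℕ} (h : n < m) : (hgt m : ℝ) ≤ hgt n / 2 := by
  change (1 / 2 : ℝ) ^ m ≤ (1 / 2 : ℝ) ^ n / 2
  have : (1 / 2 : ℝ) ^ m ≤ (1 / 2 : ℝ) ^ (n + 1) :=
    pow_le_pow_of_le_one (by norm_num) (by norm_num) h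
  rw [pow_succ] at this
  linarith

lemma bump_disjoint {n m : ℕ} {u : ℝ} (hn : bump n u ≠ 0) (hm : bump m u ≠ 0) : n = m := by
  have h1 := bump_ne_zero hn
  have h2 := bump_ne_zero hm
  have p1 := hgt_pos n
  have p2 := hgt_pos m
  rcases lt_trichotomy n m with h | h | h
  · have := hgt_lt h; linarith
  · exact h
  · have := hgt_lt h; linarith

lemma bump_cont (n : ℕ) : Continuous (bump n) := by
  unfold bump
  fun_prop

/-- one bumpSummand of the extension operator -/
def bumpSummand {Γ : Type*} (n : ℕ) (f : C(Ball Γ, ℝ)) : C(Ball (Option Γ), ℝ) :=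
  ⟨fun x => bump n (1 - x.1 none),
    (bump_cont n).comp (continuous_const.sub ((continuous_apply _).comp continuous_subtype_val))⟩
    * f.comp (thetaMap Γ n)

lemma bumpSummand_apply {Γ : Type*} (n : ℕ) (f : C(Ball Γ, ℝ)) (x : Ball (Option Γ)) :
    bumpSummand n f x = bump n (1 - x.1 none) * f (thetaMap Γ n x) := rfl

lemma bumpSummand_sum_le {Γ : Type*} (f : ℕ → C(Ball Γ, ℝ)) (C : ℝ) (hC : 0 ≤ C) (s : Finset ℕ)
    (h : ∀ n ∈ s, ‖f n‖ ≤ C) : ‖∑ n ∈ s, bumpSummand n (f n)‖ ≤ C := by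
  rw [ContinuousMap.norm_le _ hC]
  intro x
  rw [ContinuousMap.sum_apply]
  by_cases hx : ∃ n ∈ s, bump n (1 - x.1 none) ≠ 0
  · obtain ⟨n, hn, hb⟩ := hx
    rw [Finset.sum_eq_single_of_mem n hn, bumpSummand_apply, norm_mul, Real.norm_of_nonneg (bump_nonneg _ _)]
    · calc bump n (1 - x.1 none) * ‖f n (thetaMap Γ n x)‖ ≤ 1 * C :=
            mul_le_mul (bump_le _ _) (((f n).norm_coe_le_norm _).trans (h n hn))
              (norm_nonneg _) zero_le_one
        _ = C := one_mul C
    · intro m _ hm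
      rw [bumpSummand_apply]
      by_cases h0 : bump m (1 - x.1 none) = 0
      · rw [h0, zero_mul]
      · exact absurd (bump_disjoint h0 hb) hm
  · push Not at hx
    rw [Finset.sum_eq_zero fun n hn => by rw [bumpSummand_apply, hx n hn, zero_mul]]
    simpa using hC

lemma bumpSummand_summable {Γ : Type*} (f : C₀(ℕ, C(Ball Γ, ℝ))) : Summable fun n => bumpSummand n (f n) := by
  rw [summable_iff_vanishing_norm]
  intro ε hε
  have h := (czero_tendsto f).norm
  rw [norm_zero] at h
  obtain ⟨N, hN⟩ := eventually_atTop.1 (h.eventually (gt_mem_nhds (half_pos hε)))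
  refine ⟨Finset.range N, fun t ht => ?_⟩
  refine lt_of_le_of_lt (bumpSummand_sum_le _ (ε / 2) (half_pos hε).le t fun n hn => ?_) (half_lt_self hε)
  refine (hN n ?_).le
  by_contra! hlt
  exact (Finset.disjoint_left.1 ht hn) (Finset.mem_range.2 hlt)

/-- The extension operator `c₀(C(B(Γ))) → C(B(Γ ∪ {∞}))`. -/
def extOp (Γ : Type*) : C₀(ℕ, C(Ball Γ, ℝ)) →L[ℝ] C(Ball (Option Γ), ℝ) :=
  LinearMap.mkContinuous
    { toFun := fun f : C₀(ℕ, C(Ball Γ, ℝ)) => ∑' n, bumpSummand n (f n)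
      map_add' := fun f g => by
        rw [← (bumpSummand_summable f).tsum_add (bumpSummand_summable g)]
        congr 1; ext n x
        simp [bumpSummand_apply, mul_add]
      map_smul' := fun c f => by
        rw [RingHom.id_apply, ← (bumpSummand_summable f).tsum_const_smul]
        congr 1; ext n x
        simp [bumpSummand_apply, mul_left_comm] } 1
    (fun f => by
      rw [one_mul]
      exact le_of_tendsto (bumpSummand_summable f).hasSum.norm (Eventually.of_forall fun s =>
        bumpSummand_sum_le _ _ (norm_nonneg _) s fun n _ => czero_apply_le f n))

lemma extOp_apply {Γ : Type*} (f : C₀(ℕ, C(Ball Γ, ℝ))) (x : Ball (Option Γ)) :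
    extOp Γ f x = ∑' n, bump n (1 - x.1 none) * f n (thetaMap Γ n x) :=
  ((ContinuousMap.evalCLM ℝ x).map_tsum (bumpSummand_summable f))

/-- The apex-normalised slice. -/
def sliceLin (Γ : Type*) (n : ℕ) : C(Ball (Option Γ), ℝ) →ₗ[ℝ] C(Ball Γ, ℝ) where
  toFun g := ⟨fun y => g (coneMap Γ (hgt n, y)) - g (coneMap Γ (0, y)), by fun_prop⟩
  map_add' g h := by ext y; simp; ring
  map_smul' c g := by ext y; simp; ring

lemma sliceLin_apply {Γ : Type*} (n : ℕ) (g : C(Ball (Option Γ), ℝ)) (y : Ball Γ) :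
    sliceLin Γ n g y = g (coneMap Γ (hgt n, y)) - g (coneMap Γ (0, y)) := rfl

/-- The slicing operator. -/
def sliceOp (Γ : Type*) : C(Ball (Option Γ), ℝ) →L[ℝ] C₀(ℕ, C(Ball Γ, ℝ)) :=
  czeroLift (sliceLin Γ) 2
    (fun n g => by
      rw [ContinuousMap.norm_le _ (by positivity)]
      intro y
      rw [sliceLin_apply]
      refine (norm_sub_le _ _).trans ?_
      linarith [g.norm_coe_le_norm (coneMap Γ (hgt n, y)), g.norm_coe_le_norm (coneMap Γ (0, y))])
    (fun g => by
      let c := (g.comp (coneMap Γ)).curry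
      have h : Tendsto (fun n => c (hgt n)) atTop (𝓝 (c 0)) :=
        (c.continuous.tendsto 0).comp hgt_tendsto
      have h2 := h.sub_const (c 0)
      rw [sub_self] at h2
      exact h2)

lemma sliceOp_extOp {Γ : Type*} (f : C₀(ℕ, C(Ball Γ, ℝ))) : sliceOp Γ (extOp Γ f) = f := by
  ext n y
  change extOp Γ f (coneMap Γ (hgt n, y)) - extOp Γ f (coneMap Γ (0, y)) = f n y
  rw [extOp_apply, extOp_apply]
  have e1 : ∀ u : unitInterval, 1 - (coneMap Γ (u, y)).1 none = (u : ℝ) := fun u => by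
    change 1 - (1 - (u : ℝ)) = u
    ring
  simp only [e1]
  have e0 : ((0 : unitInterval) : ℝ) = 0 := rfl
  simp only [e0, bump_zero, zero_mul, tsum_zero, sub_zero]
  rw [tsum_eq_single n]
  · rw [bump_self, one_mul]
    congr 1
    refine Subtype.ext (funext fun i => ?_)
    change (hgt n : ℝ) * y.1 i / max (1 - (1 - (hgt n : ℝ))) (hgt n) = y.1 i
    rw [sub_sub_cancel, max_self]
    have := (hgt_pos n).ne'
    field_simp
  · intro m hm
    by_cases h0 : bump m (hgt n) = 0
    · rw [h0, zero_mul]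
    · exact absurd (bump_disjoint h0 (by rw [bump_self]; exact one_ne_zero)) hm

open Cardinal in
lemma exists_option_equiv (Γ : Type*) [Infinite Γ] : Nonempty (Option Γ ≃ Γ) := by
  rw [← Cardinal.eq, mk_option, add_one_eq (aleph0_le_mk Γ)]

end CZeroPart

/-- for uncountable `Γ` and an admissible pair `(a,b)`, the Banach
spaces `C(B(Γ,a,b))` and `C(B(Γ))` of continuous real functions (sup norm) are
isomorphic, i.e. linearly homeomorphic. -/
theorem statement11 {Γ : Type*} [Uncountable Γ] (a b : Γ → ℝ) (hab : Admissible a b) :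
    Nonempty (C(↥(BallAB Γ a b), ℝ) ≃L[ℝ] C(↥(Ball Γ), ℝ)) := by
  obtain ⟨s, p, hsp⟩ := exists_retract a b hab
  obtain ⟨e⟩ := exists_option_equiv Γ
  refine pelczynski
    (ContinuousMap.compCLM ℝ ℝ (inclMap a b)) (ContinuousMap.compCLM ℝ ℝ (clipMap a b hab)) ?_
    (ContinuousMap.compCLM ℝ ℝ s) (ContinuousMap.compCLM ℝ ℝ p) ?_
    ((sliceOp Γ).comp (ContinuousMap.compCLM ℝ ℝ (reindex e.symm)))
    ((ContinuousMap.compCLM ℝ ℝ (reindex e)).comp (extOp Γ)) ?_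
  · intro f
    ext x
    exact congrArg f (clip_incl a b hab x)
  · intro f
    ext x
    exact congrArg f (hsp x)
  · intro f
    have h : (ContinuousMap.compCLM ℝ ℝ (reindex e.symm))
        ((ContinuousMap.compCLM ℝ ℝ (reindex e)) (extOp Γ f)) = extOp Γ f := by
      ext x
      exact congrArg (extOp Γ f) (reindex_reindex e.symm x)
    simp only [ContinuousLinearMap.comp_apply]
    rw [h, sliceOp_extOp]

end
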